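/- arXiv:2510.19534 — 3 statements merged into one kernel-verified Lean document; each statement's English description precedes it below -/
import Mathlib

section
/- Let n ≥ 1, γ ∈ ℝ with γ > p − n, and n < p < +∞. There exists a constant C > 0, depending only on n, γ and p, such that every function u : ℝⁿ → ℝ that is continuously differentiable on ℝⁿ₊ and has finite weighted energy E_γ(u) < +∞ satisfies, for all x, y ∈ ℝⁿ₊, |u(x) − u(y)| ≤ C · |x − y|^{1 − n/p} / ( min(xₙ, yₙ)^{(n+γ)/p − 1} · max(xₙ, yₙ, |x − y|)^{1 − n/p} ) · E_γ(u)^{1/p}. -/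
open MeasureTheory Real Set
open scoped ENNReal

noncomputable section

/-- The last coordinate `xₙ` of a point of `ℝⁿ`. -/
def lastCoord (n : ℕ) (x : EuclideanSpace ℝ (Fin n)) : ℝ :=
  if h : 0 < n then x ⟨n - 1, Nat.sub_lt h one_pos⟩ else 0

/-- The open upper half-space `ℝⁿ₊`. -/
def upperHalf (n : ℕ) : Set (EuclideanSpace ℝ (Fin n)) :=
  {z | 0 < lastCoord n z}

/-- The weighted energy `E_γ(u) = ∫_{ℝⁿ₊} ‖Du(z)‖^p zₙ^γ dz`, as a value in `[0, +∞]`. -/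
def energy (n : ℕ) (γ p : ℝ) (u : EuclideanSpace ℝ (Fin n) → ℝ) : ℝ≥0∞ :=
  ∫⁻ z in upperHalf n, ENNReal.ofReal (‖fderiv ℝ u z‖ ^ p * lastCoord n z ^ γ)

theorem lastCoord_add {n : ℕ} (x y : EuclideanSpace ℝ (Fin n)) :
    lastCoord n (x + y) = lastCoord n x + lastCoord n y := by
  unfold lastCoord; split_ifs <;> simp

theorem lastCoord_sub {n : ℕ} (x y : EuclideanSpace ℝ (Fin n)) :
    lastCoord n (x - y) = lastCoord n x - lastCoord n y := by
  unfold lastCoord; split_ifs <;> simp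

theorem lastCoord_smul {n : ℕ} (c : ℝ) (x : EuclideanSpace ℝ (Fin n)) :
    lastCoord n (c • x) = c * lastCoord n x := by
  unfold lastCoord; split_ifs <;> simp

theorem abs_lastCoord_le {n : ℕ} (x : EuclideanSpace ℝ (Fin n)) :
    |lastCoord n x| ≤ ‖x‖ := by
  unfold lastCoord
  split_ifs
  · exact PiLp.norm_apply_le x _
  · simp

theorem continuous_lastCoord (n : ℕ) : Continuous (lastCoord n) := by
  unfold lastCoord
  split_ifs <;> fun_prop

theorem isOpen_upperHalf (n : ℕ) : IsOpen (upperHalf n) :=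
  isOpen_lt continuous_const (continuous_lastCoord n)

theorem convex_upperHalf (n : ℕ) : Convex ℝ (upperHalf n) :=
  convex_halfSpace_gt ⟨lastCoord_add, lastCoord_smul⟩ 0

theorem exists_norm_eq_one_lastCoord_eq_one {n : ℕ} (hn : 1 ≤ n) :
    ∃ e : EuclideanSpace ℝ (Fin n), ‖e‖ = 1 ∧ lastCoord n e = 1 := by
  refine ⟨EuclideanSpace.single ⟨n - 1, by omega⟩ 1, by simp, ?_⟩
  simp [lastCoord, show 0 < n by omega]

/-- An increment of a `C¹` function is controlled by the derivative along the segment. -/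
theorem enorm_sub_le_lintegral_fderiv {E : Type*} [NormedAddCommGroup E] [NormedSpace ℝ E]
    {S : Set E} (hSo : IsOpen S) (hSc : Convex ℝ S) {u : E → ℝ} (hu : ContDiffOn ℝ 1 u S)
    {x z : E} (hx : x ∈ S) (hz : z ∈ S) :
    ‖u z - u x‖ₑ ≤ ∫⁻ t in Ioc (0 : ℝ) 1, ‖z - x‖ₑ * ‖fderiv ℝ u (x + t • (z - x))‖ₑ := by
  have hmem : ∀ t ∈ Icc (0 : ℝ) 1, x + t • (z - x) ∈ S := fun t ht =>
    hSc.add_smul_sub_mem hx hz ht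
  have hline : ∀ t : ℝ, HasDerivAt (fun t : ℝ => x + t • (z - x)) (z - x) t := fun t => by
    simpa using ((hasDerivAt_id t).smul_const (z - x)).const_add x
  have hderiv : ∀ t ∈ uIcc (0 : ℝ) 1, HasDerivAt (fun t : ℝ => u (x + t • (z - x)))
      (fderiv ℝ u (x + t • (z - x)) (z - x)) t := by
    intro t ht
    rw [uIcc_of_le zero_le_one] at ht
    have hd : DifferentiableAt ℝ u (x + t • (z - x)) :=
      (hu.differentiableOn one_ne_zero).differentiableAt (hSo.mem_nhds (hmem t ht))
    exact hd.hasFDerivAt.comp_hasDerivAt t (hline t)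
  have hcont : ContinuousOn (fun t : ℝ => fderiv ℝ u (x + t • (z - x)) (z - x))
      (uIcc (0 : ℝ) 1) := by
    rw [uIcc_of_le zero_le_one]
    refine ContinuousOn.clm_apply ?_ continuousOn_const
    exact (hu.continuousOn_fderiv_of_isOpen hSo le_rfl).comp
      (Continuous.continuousOn (by fun_prop)) hmem
  have hftc := intervalIntegral.integral_eq_sub_of_hasDerivAt hderiv hcont.intervalIntegrable
  simp only [one_smul, add_sub_cancel, zero_smul, add_zero] at hftc
  rw [← hftc, intervalIntegral.integral_of_le zero_le_one]
  refine (enorm_integral_le_lintegral_enorm _).trans (lintegral_mono fun t => ?_)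
  rw [mul_comm]
  exact (fderiv ℝ u (x + t • (z - x))).le_opENorm (z - x)

theorem lintegral_comp_homothety {n : ℕ} (x : EuclideanSpace ℝ (Fin n)) {t : ℝ} (ht : 0 < t)
    {f : EuclideanSpace ℝ (Fin n) → ℝ≥0∞} (hf : Measurable f) :
    ∫⁻ z, f (x + t • (z - x)) = ENNReal.ofReal (t ^ (-(n : ℝ))) * ∫⁻ z, f z := by
  rw [lintegral_sub_right_eq_self (fun z => f (x + t • z)) x,
    ← lintegral_add_left_eq_self f x]
  have h := lintegral_map (μ := (volume : Measure (EuclideanSpace ℝ (Fin n))))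
    (f := fun z => f (x + z)) (g := fun z => t • z) (by fun_prop) (by fun_prop)
  rw [← h, Measure.map_addHaar_smul _ ht.ne', lintegral_smul_measure, smul_eq_mul,
    finrank_euclideanSpace_fin, abs_of_nonneg (by positivity), rpow_neg ht.le, rpow_natCast]

theorem setLIntegral_le_rpow_mul_measure {α : Type*} [MeasurableSpace α] {μ : Measure α}
    {p : ℝ} (hp : 1 ≤ p) {W : Set α} {g : α → ℝ≥0∞} (hg : Measurable g) :
    ∫⁻ z in W, g z ∂μ ≤ (∫⁻ z in W, g z ^ p ∂μ) ^ (1 / p) * μ W ^ (1 - 1 / p) := by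
  have h := eLpNorm'_le_eLpNorm'_mul_rpow_measure_univ (μ := μ.restrict W) (p := 1) (q := p)
    one_pos hp hg.aestronglyMeasurable
  simpa [eLpNorm'] using h

/-- Energy of a function on a set contracted towards `x`. -/
theorem setLIntegral_fderiv_homothety_le {n : ℕ} {p γ : ℝ} (hp : 0 ≤ p) (hγ : 0 ≤ γ)
    (u : EuclideanSpace ℝ (Fin n) → ℝ) (x : EuclideanSpace ℝ (Fin n)) {t h : ℝ} (ht : 0 < t)
    (hh : 0 < h) {W : Set (EuclideanSpace ℝ (Fin n))} (hW : MeasurableSet W)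
    (hWh : ∀ z ∈ W, h ≤ lastCoord n (x + t • (z - x))) :
    ∫⁻ z in W, ‖fderiv ℝ u (x + t • (z - x))‖ₑ ^ p ≤
      ENNReal.ofReal (t ^ (-(n : ℝ)) * h ^ (-γ)) * energy n γ p u := by
  have hmL := (continuous_lastCoord n).measurable
  have hmD := measurable_fderiv ℝ u
  set F : EuclideanSpace ℝ (Fin n) → ℝ≥0∞ := (upperHalf n).indicator
    fun z => ENNReal.ofReal (‖fderiv ℝ u z‖ ^ p * lastCoord n z ^ γ) with hF
  have hmF : Measurable F := by
    refine Measurable.indicator ?_ (isOpen_upperHalf n).measurableSet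
    fun_prop
  have hE : energy n γ p u = ∫⁻ z, F z := by
    rw [energy, hF, lintegral_indicator (isOpen_upperHalf n).measurableSet]
  have hle : ∀ z ∈ W, ‖fderiv ℝ u (x + t • (z - x))‖ₑ ^ p ≤
      ENNReal.ofReal (h ^ (-γ)) * F (x + t • (z - x)) := by
    intro z hz
    have hz' := hWh z hz
    set y := x + t • (z - x)
    have hy : y ∈ upperHalf n := hh.trans_le hz'
    rw [hF, indicator_of_mem hy, ← ENNReal.ofReal_mul (by positivity), ← ofReal_norm,
      ENNReal.ofReal_rpow_of_nonneg (norm_nonneg _) hp]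
    refine ENNReal.ofReal_le_ofReal ?_
    have h1 : 1 ≤ h ^ (-γ) * lastCoord n y ^ γ := by
      rw [rpow_neg hh.le, ← div_eq_inv_mul, one_le_div (by positivity)]
      exact rpow_le_rpow hh.le hz' hγ
    calc _ = ‖fderiv ℝ u y‖ ^ p * 1 := by ring
      _ ≤ ‖fderiv ℝ u y‖ ^ p * (h ^ (-γ) * lastCoord n y ^ γ) := by gcongr
      _ = _ := by ring
  calc _ ≤ ∫⁻ z in W, ENNReal.ofReal (h ^ (-γ)) * F (x + t • (z - x)) :=
        setLIntegral_mono' hW hle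
    _ ≤ ∫⁻ z, ENNReal.ofReal (h ^ (-γ)) * F (x + t • (z - x)) := setLIntegral_le_lintegral _ _
    _ = _ := by
      rw [lintegral_const_mul _ (by fun_prop), lintegral_comp_homothety x ht hmF, hE,
        ENNReal.ofReal_mul (by positivity)]
      ring

/-- Mean oscillation of `u` around `x` over a set lying well above `x`. -/
theorem setLIntegral_enorm_sub_le {n : ℕ} {p γ : ℝ} (hp : 1 ≤ p) (hγ : 0 ≤ γ)
    {u : EuclideanSpace ℝ (Fin n) → ℝ} (hu : ContDiffOn ℝ 1 u (upperHalf n))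
    {x : EuclideanSpace ℝ (Fin n)} (hx : x ∈ upperHalf n) {d R : ℝ} (hd : 0 < d)
    {W : Set (EuclideanSpace ℝ (Fin n))} (hW : MeasurableSet W)
    (hWh : ∀ z ∈ W, lastCoord n x + d ≤ lastCoord n z) (hWR : ∀ z ∈ W, ‖z - x‖ ≤ R) :
    ∫⁻ z in W, ‖u z - u x‖ₑ ≤ ENNReal.ofReal R *
      ((∫⁻ t in Ioc (0 : ℝ) 1,
          ENNReal.ofReal (t ^ (-(n / p)) * (lastCoord n x + t * d) ^ (-(γ / p)))) *
        energy n γ p u ^ (1 / p) * volume W ^ (1 - 1 / p)) := by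
  have hx' : 0 < lastCoord n x := hx
  have hp0 : 0 < p := by linarith
  have hmD := measurable_fderiv ℝ u
  have hm : Measurable (Function.uncurry fun (z : EuclideanSpace ℝ (Fin n)) (t : ℝ) =>
      ‖fderiv ℝ u (x + t • (z - x))‖ₑ) := by
    unfold Function.uncurry
    refine measurable_enorm.comp (hmD.comp ?_)
    fun_prop
  calc ∫⁻ z in W, ‖u z - u x‖ₑ
      ≤ ∫⁻ z in W, ∫⁻ t in Ioc (0 : ℝ) 1,
          ENNReal.ofReal R * ‖fderiv ℝ u (x + t • (z - x))‖ₑ := by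
        refine setLIntegral_mono' hW fun z hz => ?_
        have hzU : z ∈ upperHalf n := show 0 < lastCoord n z by linarith [hWh z hz]
        refine (enorm_sub_le_lintegral_fderiv (isOpen_upperHalf n) (convex_upperHalf n)
          hu hx hzU).trans (lintegral_mono fun t => ?_)
        gcongr
        rw [← ofReal_norm]
        exact ENNReal.ofReal_le_ofReal (hWR z hz)
    _ = ENNReal.ofReal R * ∫⁻ t in Ioc (0 : ℝ) 1, ∫⁻ z in W,
          ‖fderiv ℝ u (x + t • (z - x))‖ₑ := by
        rw [lintegral_lintegral_swap (hm.const_mul _).aemeasurable]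
        simp_rw [lintegral_const_mul' _ _ ENNReal.ofReal_ne_top]
    _ ≤ _ := by
        gcongr
        rw [mul_assoc, ← lintegral_mul_const _ (by fun_prop)]
        refine setLIntegral_mono' measurableSet_Ioc fun t ht => ?_
        have ht0 := ht.1
        have hh : 0 < lastCoord n x + t * d := by positivity
        refine (setLIntegral_le_rpow_mul_measure hp
          (hm.comp (measurable_id.prodMk measurable_const))).trans ?_
        rw [← mul_assoc]
        gcongr
        have hkey := setLIntegral_fderiv_homothety_le hp0.le hγ u x ht0 hh hW fun z hz => by
          rw [lastCoord_add, lastCoord_smul, lastCoord_sub]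
          nlinarith [hWh z hz]
        refine (ENNReal.rpow_le_rpow hkey (by positivity)).trans_eq ?_
        rw [ENNReal.mul_rpow_of_nonneg _ _ (by positivity),
          ENNReal.ofReal_rpow_of_nonneg (by positivity) (by positivity),
          mul_rpow (by positivity) (by positivity), ← rpow_mul ht0.le, ← rpow_mul hh.le]
        congr 4 <;> ring_nf

theorem setLIntegral_rpow_Ioc {r s e : ℝ} (hr : 0 ≤ r) (hrs : r ≤ s)
    (h : -1 < e ∨ e ≠ -1 ∧ 0 < r) :
    ∫⁻ t in Ioc r s, ENNReal.ofReal (t ^ e) =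
      ENNReal.ofReal ((s ^ (e + 1) - r ^ (e + 1)) / (e + 1)) := by
  have h0 : 0 < r → (0 : ℝ) ∉ uIcc r s := fun hr0 => by
    rw [uIcc_of_le hrs]; exact fun hm => hr0.not_ge hm.1
  have hint : IntervalIntegrable (fun t : ℝ => t ^ e) volume r s := by
    rcases h with h | h
    · exact intervalIntegral.intervalIntegrable_rpow' h
    · exact intervalIntegral.intervalIntegrable_rpow (Or.inr (h0 h.2))
  rw [← integral_rpow (h.imp_right fun h => ⟨h.1, h0 h.2⟩),
    intervalIntegral.integral_of_le hrs, ofReal_integral_eq_lintegral_ofReal hint.1]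
  filter_upwards [ae_restrict_mem measurableSet_Ioc] with t ht
  exact rpow_nonneg (hr.trans ht.1.le) e

theorem setLIntegral_rpow_mul_rpow_le {a b h d : ℝ} (ha1 : a < 1) (hb : 0 ≤ b)
    (hab : 1 < a + b) (hh : 0 < h) (hd : 0 < d) :
    ∫⁻ t in Ioc (0 : ℝ) 1, ENNReal.ofReal (t ^ (-a) * (h + t * d) ^ (-b)) ≤
      ENNReal.ofReal ((1 / (1 - a) + 1 / (a + b - 1)) *
        (h ^ (1 - a - b) / max h d ^ (1 - a))) := by
  have hA : 0 < 1 - a := by linarith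
  have hB : 0 < a + b - 1 := by linarith
  have hnear : ∀ s, 0 < s → ∫⁻ t in Ioc (0 : ℝ) s,
      ENNReal.ofReal (t ^ (-a) * (h + t * d) ^ (-b)) ≤
        ENNReal.ofReal (h ^ (-b) * (s ^ (1 - a) / (1 - a))) := by
    intro s hs
    calc _ ≤ ∫⁻ t in Ioc (0 : ℝ) s, ENNReal.ofReal (h ^ (-b)) * ENNReal.ofReal (t ^ (-a)) := by
          refine setLIntegral_mono' measurableSet_Ioc fun t ht => ?_
          have ht0 := ht.1
          rw [← ENNReal.ofReal_mul (by positivity), mul_comm]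
          refine ENNReal.ofReal_le_ofReal ?_
          gcongr ?_ * _
          exact rpow_le_rpow_of_nonpos hh (by nlinarith) (neg_nonpos.2 hb)
      _ = _ := by
          rw [lintegral_const_mul _ (by fun_prop),
            setLIntegral_rpow_Ioc le_rfl hs.le (Or.inl (by linarith)),
            ← ENNReal.ofReal_mul (by positivity), zero_rpow (by linarith), neg_add_eq_sub, sub_zero]
  rcases le_or_gt d h with hdh | hhd
  · refine (hnear 1 one_pos).trans (ENNReal.ofReal_le_ofReal ?_)
    rw [max_eq_left hdh, ← rpow_sub hh, one_rpow, show 1 - a - b - (1 - a) = -b by ring, mul_comm]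
    gcongr
    exact le_add_of_nonneg_right (by positivity)
  · set s := h / d with hs
    have hs0 : 0 < s := by positivity
    have hs1 : s ≤ 1 := by rw [hs, div_le_one hd]; exact hhd.le
    have hfar : ∫⁻ t in Ioc s 1, ENNReal.ofReal (t ^ (-a) * (h + t * d) ^ (-b)) ≤
        ENNReal.ofReal (d ^ (-b) * (s ^ (1 - a - b) / (a + b - 1))) := by
      calc _ ≤ ∫⁻ t in Ioc s 1, ENNReal.ofReal (d ^ (-b)) * ENNReal.ofReal (t ^ (-a - b)) := by
            refine setLIntegral_mono' measurableSet_Ioc fun t ht => ?_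
            have ht0 : 0 < t := hs0.trans ht.1
            rw [← ENNReal.ofReal_mul (by positivity)]
            refine ENNReal.ofReal_le_ofReal ?_
            calc _ ≤ t ^ (-a) * (t * d) ^ (-b) := by
                  gcongr ?_ * ?_
                  exact rpow_le_rpow_of_nonpos (by positivity) (by linarith) (neg_nonpos.2 hb)
              _ = _ := by
                  rw [mul_rpow ht0.le hd.le, sub_eq_add_neg, rpow_add ht0]; ring
        _ = ENNReal.ofReal (d ^ (-b) * ((1 - s ^ (1 - a - b)) / (1 - a - b))) := by
            rw [lintegral_const_mul _ (by fun_prop),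
              setLIntegral_rpow_Ioc hs0.le hs1 (Or.inr ⟨by linarith, hs0⟩),
              ← ENNReal.ofReal_mul (by positivity), one_rpow,
              show -a - b + 1 = 1 - a - b by ring]
        _ ≤ _ := by
            refine ENNReal.ofReal_le_ofReal ?_
            gcongr ?_ * ?_
            rw [← neg_div_neg_eq, show -(1 - a - b) = a + b - 1 by ring]
            gcongr
            linarith
    rw [← Ioc_union_Ioc_eq_Ioc hs0.le hs1]
    refine (lintegral_union_le _ _ _).trans ((add_le_add (hnear s hs0) hfar).trans_eq ?_)
    rw [← ENNReal.ofReal_add (by positivity) (by positivity), max_eq_right hhd.le, hs,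
      div_rpow hh.le hd.le, div_rpow hh.le hd.le]
    congr 1
    have e1 : h ^ (1 - a - b) = h ^ (1 - a) * h ^ (-b) := by rw [← rpow_add hh]; ring_nf
    have e2 : d ^ (1 - a - b) = d ^ (1 - a) * d ^ (-b) := by rw [← rpow_add hd]; ring_nf
    rw [e1, e2]
    have := (rpow_pos_of_pos hd (1 - a)).ne'
    have := (rpow_pos_of_pos hd (-b)).ne'
    field_simp

/-- Weighted Morrey–Sobolev inequality on the half-space, case `γ > p - n`. -/
theorem weighted_morrey_sobolev_gt (n : ℕ) (hn : 1 ≤ n) (p γ : ℝ)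
    (hnp : (n : ℝ) < p) (hγ : p - n < γ) :
    ∃ C : ℝ, 0 < C ∧
      ∀ u : EuclideanSpace ℝ (Fin n) → ℝ,
        ContDiffOn ℝ 1 u (upperHalf n) →
        energy n γ p u < ⊤ →
        ∀ x ∈ upperHalf n, ∀ y ∈ upperHalf n,
          |u x - u y| ≤
            C * (‖x - y‖ ^ (1 - (n : ℝ) / p) /
              (min (lastCoord n x) (lastCoord n y) ^ (((n : ℝ) + γ) / p - 1) *
                max (max (lastCoord n x) (lastCoord n y)) ‖x - y‖ ^ (1 - (n : ℝ) / p))) *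
            (energy n γ p u).toReal ^ (1 / p) := by
  have hn0 : (0 : ℝ) < n := by exact_mod_cast hn
  have hp0 : 0 < p := hn0.trans hnp
  have hp1 : 1 ≤ p := le_trans (by exact_mod_cast hn) hnp.le
  have hγ0 : 0 ≤ γ := by linarith
  have : Nonempty (Fin n) := ⟨⟨0, hn⟩⟩
  obtain ⟨e, he, hel⟩ := exists_norm_eq_one_lastCoord_eq_one hn
  set ω := (volume (Metric.ball (0 : EuclideanSpace ℝ (Fin n)) 1)).toReal
  have hω0 : 0 < ω := ENNReal.toReal_pos (Metric.measure_ball_pos _ _ one_pos).ne'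
    measure_ball_lt_top.ne
  set a := (n : ℝ) / p with ha
  set b := γ / p with hb
  have ha1 : a < 1 := (div_lt_one hp0).2 hnp
  have hb0 : 0 ≤ b := by positivity
  have hab : 1 < a + b := by rw [ha, hb, ← add_div, lt_div_iff₀ hp0]; linarith
  set K := 1 / (1 - a) + 1 / (a + b - 1)
  have hK0 : 0 < K := by
    have : 0 < 1 - a := by linarith
    have : 0 < a + b - 1 := by linarith
    positivity
  refine ⟨20 * K * ω ^ (-(1 / p)), by positivity, fun u hu hE x hx y hy => ?_⟩
  rcases eq_or_ne x y with rfl | hxy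
  · have : 1 - a ≠ 0 := by linarith
    simp [zero_rpow this]
  set d := ‖x - y‖ with hd
  have hd0 : 0 < d := norm_pos_iff.2 (sub_ne_zero.2 hxy)
  set hX := lastCoord n x
  set hY := lastCoord n y
  have hX0 : 0 < hX := hx
  have hY0 : 0 < hY := hy
  set m := min hX hY with hm
  have hm0 : 0 < m := lt_min hX0 hY0
  have hdist : |hX - hY| ≤ d := by
    simpa only [lastCoord_sub] using abs_lastCoord_le (x - y)
  set c := x + (3 * d) • e with hc
  set W := Metric.ball c d with hW
  have hWx : ∀ z ∈ W, hX + 2 * d ≤ lastCoord n z ∧ ‖z - x‖ ≤ 4 * d := by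
    intro z hz
    have hzc : ‖z - c‖ < d := mem_ball_iff_norm.1 hz
    constructor
    · have h1 := (abs_le.1 ((abs_lastCoord_le (z - c)).trans hzc.le)).1
      rw [lastCoord_sub, hc, lastCoord_add, lastCoord_smul, hel] at h1
      linarith
    · have h1 : z - x = (z - c) + (3 * d) • e := by rw [hc]; abel
      have h2 : ‖(3 * d) • e‖ = 3 * d := by
        rw [norm_smul, he, mul_one, Real.norm_of_nonneg (by positivity)]
      rw [h1]
      linarith [norm_add_le (z - c) ((3 * d) • e)]
  have hmean : ∀ v ∈ upperHalf n, m ≤ lastCoord n v →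
      (∀ z ∈ W, lastCoord n v + d ≤ lastCoord n z) → (∀ z ∈ W, ‖z - v‖ ≤ 5 * d) →
      ∫⁻ z in W, ‖u z - u v‖ₑ ≤ ENNReal.ofReal (5 * d) *
        (ENNReal.ofReal (K * (m ^ (1 - a - b) / max m d ^ (1 - a))) *
          energy n γ p u ^ (1 / p) * volume W ^ (1 - 1 / p)) := by
    intro v hv hmv h1 h2
    refine (setLIntegral_enorm_sub_le hp1 hγ0 hu hv hd0
      measurableSet_ball h1 h2).trans ?_
    gcongr
    refine le_trans (setLIntegral_mono' measurableSet_Ioc fun t ht => ?_)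
      (setLIntegral_rpow_mul_rpow_le ha1 hb0 hab hm0 hd0)
    have ht0 := ht.1
    refine ENNReal.ofReal_le_ofReal ?_
    gcongr ?_ * ?_
    exact rpow_le_rpow_of_nonpos (by positivity) (by linarith) (neg_nonpos.2 hb0)
  set B := m ^ (1 - a - b) / max m d ^ (1 - a) with hB
  have hB0 : 0 ≤ B := by positivity
  set T := ENNReal.ofReal (5 * d) * (ENNReal.ofReal (K * B) *
          energy n γ p u ^ (1 / p) * volume W ^ (1 - 1 / p)) with hT
  have hTx : ∫⁻ z in W, ‖u z - u x‖ₑ ≤ T := hmean x hx (min_le_left _ _)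
    (fun z hz => by linarith [(hWx z hz).1]) (fun z hz => by linarith [(hWx z hz).2])
  have hTy : ∫⁻ z in W, ‖u z - u y‖ₑ ≤ T := hmean y hy (min_le_right _ _)
    (fun z hz => by linarith [(hWx z hz).1, (abs_le.1 hdist).1])
    (fun z hz => by linarith [(hWx z hz).2, norm_sub_le_norm_sub_add_norm_sub z x y])
  have hWtop : volume W ≠ ⊤ := measure_ball_lt_top.ne
  have hq : 0 ≤ 1 - 1 / p := by
    rw [sub_nonneg, div_le_one hp0]; exact hp1
  have hTtop : T ≠ ⊤ := by
    refine ENNReal.mul_ne_top ENNReal.ofReal_ne_top (ENNReal.mul_ne_top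
      (ENNReal.mul_ne_top ENNReal.ofReal_ne_top ?_) ?_)
    · exact ENNReal.rpow_ne_top_of_nonneg (by positivity) hE.ne
    · exact ENNReal.rpow_ne_top_of_nonneg hq hWtop
  have hmeas : AEMeasurable (fun z => ‖u z - u x‖ₑ) (volume.restrict W) := by
    refine (ContinuousOn.aemeasurable ?_ measurableSet_ball).enorm
    refine (hu.continuousOn.mono fun z hz => ?_).sub continuousOn_const
    exact show 0 < lastCoord n z by linarith [(hWx z hz).1]
  have hsum : volume W * ‖u x - u y‖ₑ ≤ 2 * T := by
    calc volume W * ‖u x - u y‖ₑ = ∫⁻ _ in W, ‖u x - u y‖ₑ := by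
          rw [setLIntegral_const, mul_comm]
      _ ≤ ∫⁻ z in W, (‖u z - u x‖ₑ + ‖u z - u y‖ₑ) := by
          refine lintegral_mono fun z => ?_
          rw [← enorm_neg (u z - u x), neg_sub]
          simpa using enorm_add_le (u x - u z) (u z - u y)
      _ ≤ 2 * T := by
          rw [lintegral_add_left' hmeas, two_mul]
          exact add_le_add hTx hTy
  have hreal := ENNReal.toReal_mono (ENNReal.mul_ne_top (by simp) hTtop) hsum
  have hvol : (volume W).toReal = d ^ (n : ℝ) * ω := by
    rw [hW, Measure.addHaar_ball _ _ hd0.le, finrank_euclideanSpace_fin, ENNReal.toReal_mul,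
      ENNReal.toReal_ofReal (by positivity), rpow_natCast]
  set G := (energy n γ p u).toReal ^ (1 / p) with hG
  have hG0 : 0 ≤ G := by positivity
  set w := (volume W).toReal with hw
  have hw0 : 0 < w := by rw [hvol]; positivity
  rw [hT] at hreal
  simp only [ENNReal.toReal_mul, ENNReal.toReal_ofNat, ← ENNReal.toReal_rpow,
    toReal_enorm, Real.norm_eq_abs] at hreal
  rw [ENNReal.toReal_ofReal (by positivity), ENNReal.toReal_ofReal (by positivity),
    sub_eq_add_neg 1 (1 / p), ← hw, ← hG, rpow_add hw0, rpow_one] at hreal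
  have hdiff : |u x - u y| ≤ 10 * d * (K * B * G) * w ^ (-(1 / p)) := by
    refine le_of_mul_le_mul_left (hreal.trans_eq ?_) hw0
    ring
  have hwp : d * w ^ (-(1 / p)) = d ^ (1 - a) * ω ^ (-(1 / p)) := by
    rw [hvol, mul_rpow (by positivity) hω0.le, ← rpow_mul hd0.le, ← mul_assoc, sub_eq_add_neg,
      rpow_add hd0, rpow_one, ha]
    congr 3
    ring
  have hmax : max (max hX hY) d ≤ 2 * max m d := by
    have h1 : hX ≤ m + d := by
      rw [hm, ← min_add_add_right]
      exact le_min (by linarith) (by linarith [(abs_le.1 hdist).2])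
    have h2 : hY ≤ m + d := by
      rw [hm, ← min_add_add_right]
      exact le_min (by linarith [(abs_le.1 hdist).1]) (by linarith)
    have h3 := le_max_left m d
    have h4 := le_max_right m d
    exact max_le (max_le (by linarith) (by linarith)) (by linarith)
  set M := max (max hX hY) d with hM
  have hM0 : 0 < M := lt_max_of_lt_right hd0
  have hBle : B ≤ 2 * (m ^ (1 - a - b) / M ^ (1 - a)) := by
    have h1 : M ^ (1 - a) ≤ 2 * max m d ^ (1 - a) := by
      calc M ^ (1 - a) ≤ (2 * max m d) ^ (1 - a) :=
            rpow_le_rpow hM0.le hmax (by linarith)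
        _ = 2 ^ (1 - a) * max m d ^ (1 - a) := mul_rpow zero_le_two (by positivity)
        _ ≤ 2 ^ (1 : ℝ) * max m d ^ (1 - a) := by
            gcongr
            · exact one_le_two
            · linarith [show 0 ≤ a by positivity]
        _ = _ := by rw [rpow_one]
    rw [hB, ← mul_div_assoc, div_le_div_iff₀ (by positivity) (by positivity)]
    calc _ ≤ m ^ (1 - a - b) * (2 * max m d ^ (1 - a)) := by gcongr
      _ = _ := by ring
  have hexp : ((n : ℝ) + γ) / p - 1 = -(1 - a - b) := by rw [add_div]; ring
  rw [hexp, rpow_neg hm0.le]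
  calc |u x - u y| ≤ 10 * (K * B * G) * (d * w ^ (-(1 / p))) := hdiff.trans_eq (by ring)
    _ ≤ 10 * (K * (2 * (m ^ (1 - a - b) / M ^ (1 - a))) * G) *
        (d ^ (1 - a) * ω ^ (-(1 / p))) := by rw [hwp]; gcongr
    _ = _ := by
      have := (rpow_pos_of_pos hm0 (1 - a - b)).ne'
      field_simp
      ring
end
end

section
/- Let n ≥ 1, γ ∈ ℝ with γ < p − n, and n < p < +∞. There exists a constant C > 0, depending only on n, γ and p, such that every function u : ℝⁿ → ℝ that is continuously differentiable on ℝⁿ₊ and has finite weighted energy E_γ(u) < +∞ satisfies, for all x, y ∈ ℝⁿ₊, |u(x) − u(y)| ≤ C · |x − y|^{1 − n/p} / max(xₙ, yₙ, |x − y|)^{γ/p} · E_γ(u)^{1/p}. -/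
open MeasureTheory Real Set
open scoped ENNReal

noncomputable section

theorem lintegral_le_rpow_mul_measure {α : Type*} [MeasurableSpace α] (μ : Measure α) {p : ℝ}
    (hp : 1 < p) {f : α → ℝ≥0∞} (hf : AEMeasurable f μ) :
    ∫⁻ a, f a ∂μ ≤ (∫⁻ a, f a ^ p ∂μ) ^ (1 / p) * μ univ ^ (1 - 1 / p) := by
  have hpq := Real.HolderConjugate.conjExponent hp
  have h := ENNReal.lintegral_mul_le_Lp_mul_Lq μ hpq hf (aemeasurable_const (b := (1 : ℝ≥0∞)))
  have hq : 1 / Real.conjExponent p = 1 - 1 / p := by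
    have := hpq.inv_add_inv_eq_one
    simp only [one_div]; linarith
  simpa [hq] using h

theorem lintegral_comp_homothety_s2 {E : Type*} [NormedAddCommGroup E] [NormedSpace ℝ E]
    [FiniteDimensional ℝ E] [MeasurableSpace E] [BorelSpace E] (μ : Measure E)
    [μ.IsAddHaarMeasure] (x : E) {t : ℝ} (ht : 0 < t) {F : E → ℝ≥0∞} (hF : Measurable F) :
    ∫⁻ z, F (x + t • (z - x)) ∂μ
      = ENNReal.ofReal ((t ^ Module.finrank ℝ E)⁻¹) * ∫⁻ z, F z ∂μ := by
  rw [lintegral_sub_right_eq_self (μ := μ) (fun z => F (x + t • z)) x,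
    ← lintegral_map (f := fun z => F (x + z)) (g := (t • · : E → E)) (by fun_prop) (by fun_prop),
    Measure.map_addHaar_smul μ ht.ne', lintegral_smul_measure,
    lintegral_add_left_eq_self, abs_of_pos (by positivity), smul_eq_mul]

theorem enorm_sub_le_lintegral_segment {E : Type*} [NormedAddCommGroup E] [NormedSpace ℝ E]
    {u : E → ℝ} {s : Set E} (hs : IsOpen s) (hc : Convex ℝ s) (hu : ContDiffOn ℝ 1 u s)
    {x z : E} (hx : x ∈ s) (hz : z ∈ s) :
    ‖u z - u x‖ₑ ≤ ∫⁻ t in Icc (0 : ℝ) 1, ‖fderiv ℝ u (x + t • (z - x))‖ₑ * ‖z - x‖ₑ := by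
  have hmem : ∀ t ∈ Icc (0 : ℝ) 1, x + t • (z - x) ∈ s := fun t ht =>
    hc.add_smul_sub_mem hx hz ht
  have hcd : ContDiffOn ℝ 1 (fun t : ℝ => u (x + t • (z - x))) (Icc 0 1) :=
    hu.comp (by fun_prop) hmem
  have h := enorm_sub_le_lintegral_deriv_of_contDiffOn_Icc hcd zero_le_one
  simp only [one_smul, add_sub_cancel, zero_smul, add_zero] at h
  refine h.trans (setLIntegral_mono' measurableSet_Icc fun t ht => ?_)
  have hd : HasDerivAt (fun t : ℝ => x + t • (z - x)) (z - x) t := by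
    simpa using ((hasDerivAt_id t).smul_const (z - x)).const_add x
  have hf := ((hu.differentiableOn one_ne_zero).differentiableAt
    (hs.mem_nhds (hmem t ht))).hasFDerivAt
  have hcomp := hf.comp_hasDerivAt t hd
  rw [show deriv (fun t : ℝ => u (x + t • (z - x))) t = _ from hcomp.deriv]
  exact ContinuousLinearMap.le_opENorm _ _

theorem lintegral_enorm_sub_le {E : Type*} [NormedAddCommGroup E] [NormedSpace ℝ E]
    [FiniteDimensional ℝ E] [MeasurableSpace E] [BorelSpace E] (μ : Measure E) [SFinite μ]
    {u : E → ℝ} {s B : Set E} (hs : IsOpen s) (hc : Convex ℝ s) (hu : ContDiffOn ℝ 1 u s)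
    (hB : MeasurableSet B) (hBs : B ⊆ s) {x : E} (hx : x ∈ s) {R : ℝ}
    (hR : ∀ z ∈ B, ‖z - x‖ ≤ R) :
    ∫⁻ z in B, ‖u z - u x‖ₑ ∂μ ≤
      ∫⁻ t in Ioo (0 : ℝ) 1, ENNReal.ofReal R *
        ∫⁻ z in B, ‖fderiv ℝ u (x + t • (z - x))‖ₑ ∂μ := by
  have hm : Measurable (fderiv ℝ u) := measurable_fderiv ℝ u
  have hm2 : Measurable fun q : E × ℝ => ‖fderiv ℝ u (x + q.2 • (q.1 - x))‖ₑ := by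
    fun_prop
  calc ∫⁻ z in B, ‖u z - u x‖ₑ ∂μ
      ≤ ∫⁻ z in B, (∫⁻ t in Icc (0 : ℝ) 1,
          ENNReal.ofReal R * ‖fderiv ℝ u (x + t • (z - x))‖ₑ) ∂μ := by
        refine setLIntegral_mono' hB fun z hz =>
          (enorm_sub_le_lintegral_segment hs hc hu hx (hBs hz)).trans ?_
        refine lintegral_mono fun t => ?_
        rw [mul_comm, ← ofReal_norm (z - x)]
        gcongr
        exact hR z hz
    _ = ∫⁻ t in Icc (0 : ℝ) 1, (∫⁻ z in B,
          ENNReal.ofReal R * ‖fderiv ℝ u (x + t • (z - x))‖ₑ ∂μ) :=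
        lintegral_lintegral_swap (hm2.const_mul _).aemeasurable
    _ = _ := by
        rw [← restrict_Ioo_eq_restrict_Icc]
        refine lintegral_congr fun t => ?_
        exact lintegral_const_mul _ (by fun_prop)

theorem one_le_mul_rpow_of_mem_Icc {γ m t w : ℝ} (hm : 0 < m) (ht : 0 < t)
    (h1 : t * m ≤ w) (h2 : w ≤ 4 * m) :
    1 ≤ 4 ^ |γ| * m ^ (-γ) * t ^ (-max γ 0) * w ^ γ := by
  have hw : 0 < w := lt_of_lt_of_le (by positivity) h1
  rcases le_total 0 γ with h | h
  · rw [max_eq_left h]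
    have h3 : (t * m) ^ γ ≤ w ^ γ := rpow_le_rpow (by positivity) h1 h
    have h4 : (1 : ℝ) ≤ 4 ^ |γ| := one_le_rpow (by norm_num) (abs_nonneg _)
    calc (1 : ℝ) = m ^ (-γ) * t ^ (-γ) * (t * m) ^ γ := by
          rw [mul_rpow ht.le hm.le, rpow_neg hm.le, rpow_neg ht.le]
          field_simp
      _ ≤ m ^ (-γ) * t ^ (-γ) * w ^ γ := by gcongr
      _ ≤ 4 ^ |γ| * (m ^ (-γ) * t ^ (-γ) * w ^ γ) := le_mul_of_one_le_left (by positivity) h4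
      _ = _ := by ring
  · rw [max_eq_right h, abs_of_nonpos h, neg_zero, rpow_zero, mul_one,
      ← mul_rpow (by norm_num) hm.le]
    have h3 : (4 * m) ^ γ ≤ w ^ γ := rpow_le_rpow_of_nonpos hw h2 h
    calc (1 : ℝ) = (4 * m) ^ (-γ) * (4 * m) ^ γ := by
          rw [← rpow_add (by positivity)]; simp
      _ ≤ _ := by gcongr

theorem lastCoord_eq {n : ℕ} (hn : 0 < n) (x : EuclideanSpace ℝ (Fin n)) :
    lastCoord n x = x ⟨n - 1, Nat.sub_lt hn one_pos⟩ := dif_pos hn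

theorem lastCoord_add_smul_sub {n : ℕ} (x z : EuclideanSpace ℝ (Fin n)) (t : ℝ) :
    lastCoord n (x + t • (z - x)) = lastCoord n x + t * (lastCoord n z - lastCoord n x) := by
  unfold lastCoord
  split_ifs <;> simp

theorem abs_lastCoord_sub_le {n : ℕ} (x y : EuclideanSpace ℝ (Fin n)) :
    |lastCoord n x - lastCoord n y| ≤ ‖x - y‖ := by
  unfold lastCoord
  split_ifs with h
  · exact PiLp.norm_apply_le (x - y) ⟨n - 1, Nat.sub_lt h one_pos⟩
  · simp

theorem lintegral_enorm_fderiv_segment_le {n : ℕ} {p γ : ℝ} (hp : 1 < p)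
    (u : EuclideanSpace ℝ (Fin n) → ℝ) (x : EuclideanSpace ℝ (Fin n))
    {B : Set (EuclideanSpace ℝ (Fin n))} (hB : MeasurableSet B) {m t : ℝ} (hm : 0 < m)
    (ht : 0 < t) (hlow : ∀ z ∈ B, t * m ≤ lastCoord n (x + t • (z - x)))
    (hup : ∀ z ∈ B, lastCoord n (x + t • (z - x)) ≤ 4 * m) :
    ∫⁻ z in B, ‖fderiv ℝ u (x + t • (z - x))‖ₑ ≤
      ENNReal.ofReal (t ^ (-((n + max γ 0) / p))) *
        (ENNReal.ofReal (4 ^ |γ| * m ^ (-γ)) * energy n γ p u) ^ (1 / p) *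
          volume B ^ (1 - 1 / p) := by
  have hp0 : 0 < p := by linarith
  have hmf : Measurable (fderiv ℝ u) := measurable_fderiv ℝ u
  have hml : Measurable (lastCoord n) := (continuous_lastCoord n).measurable
  set G : EuclideanSpace ℝ (Fin n) → ℝ≥0∞ := (upperHalf n).indicator
    fun z => ENNReal.ofReal (‖fderiv ℝ u z‖ ^ p * lastCoord n z ^ γ) with hG
  have hGm : Measurable G :=
    Measurable.indicator (by fun_prop) (isOpen_upperHalf n).measurableSet
  have hGi : ∫⁻ z, G z = energy n γ p u :=
    lintegral_indicator (isOpen_upperHalf n).measurableSet _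
  refine (lintegral_le_rpow_mul_measure (volume.restrict B) hp (by fun_prop)).trans ?_
  rw [Measure.restrict_apply_univ]
  gcongr ?_ * _
  have key : ∫⁻ z in B, ‖fderiv ℝ u (x + t • (z - x))‖ₑ ^ p ≤
      ENNReal.ofReal (t ^ (-(n + max γ 0))) *
        (ENNReal.ofReal (4 ^ |γ| * m ^ (-γ)) * energy n γ p u) := by
    calc ∫⁻ z in B, ‖fderiv ℝ u (x + t • (z - x))‖ₑ ^ p
        ≤ ∫⁻ z in B, ENNReal.ofReal (4 ^ |γ| * m ^ (-γ) * t ^ (-max γ 0)) *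
            G (x + t • (z - x)) := by
          refine setLIntegral_mono' hB fun z hz => ?_
          set w := x + t • (z - x)
          have hw : 0 < lastCoord n w := lt_of_lt_of_le (by positivity) (hlow z hz)
          rw [hG, indicator_of_mem (show w ∈ upperHalf n from hw), ← ofReal_norm,
            ENNReal.ofReal_rpow_of_nonneg (norm_nonneg _) hp0.le,
            ← ENNReal.ofReal_mul (by positivity)]
          refine ENNReal.ofReal_le_ofReal ?_
          have h1 := one_le_mul_rpow_of_mem_Icc (γ := γ) hm ht (hlow z hz) (hup z hz)
          calc ‖fderiv ℝ u w‖ ^ p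
              ≤ (4 ^ |γ| * m ^ (-γ) * t ^ (-max γ 0) * lastCoord n w ^ γ) *
                  ‖fderiv ℝ u w‖ ^ p := le_mul_of_one_le_left (by positivity) h1
            _ = _ := by ring
      _ ≤ ∫⁻ z, ENNReal.ofReal (4 ^ |γ| * m ^ (-γ) * t ^ (-max γ 0)) *
            G (x + t • (z - x)) := setLIntegral_le_lintegral _ _
      _ = _ := by
          rw [lintegral_const_mul _ (by fun_prop), lintegral_comp_homothety_s2 volume x ht hGm, hGi,
            ← mul_assoc, ← mul_assoc, ← ENNReal.ofReal_mul (by positivity),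
            ← ENNReal.ofReal_mul (by positivity)]
          congr 2
          rw [finrank_euclideanSpace_fin, neg_add, rpow_add ht, rpow_neg ht.le, rpow_neg ht.le,
            rpow_natCast]
          ring
  refine (ENNReal.rpow_le_rpow key (by positivity)).trans_eq ?_
  rw [ENNReal.mul_rpow_of_nonneg _ _ (by positivity),
    ENNReal.ofReal_rpow_of_nonneg (by positivity) (by positivity), ← rpow_mul ht.le]
  congr 3
  ring

theorem lintegral_enorm_sub_ball_le {n : ℕ} {p γ : ℝ} (hp : 1 < p)
    {u : EuclideanSpace ℝ (Fin n) → ℝ} (hu : ContDiffOn ℝ 1 u (upperHalf n))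
    {x : EuclideanSpace ℝ (Fin n)} (hx : x ∈ upperHalf n)
    {B : Set (EuclideanSpace ℝ (Fin n))} (hB : MeasurableSet B) {m R : ℝ} (hm : 0 < m)
    (hR : ∀ z ∈ B, ‖z - x‖ ≤ R) (hxm : lastCoord n x ≤ 4 * m)
    (hlow : ∀ z ∈ B, m ≤ lastCoord n z) (hup : ∀ z ∈ B, lastCoord n z ≤ 4 * m) :
    ∫⁻ z in B, ‖u z - u x‖ₑ ≤
      ENNReal.ofReal R * ((∫⁻ t in Ioo (0 : ℝ) 1, ENNReal.ofReal (t ^ (-((n + max γ 0) / p)))) *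
        ((ENNReal.ofReal (4 ^ |γ| * m ^ (-γ)) * energy n γ p u) ^ (1 / p) *
          volume B ^ (1 - 1 / p))) := by
  have hx0 : 0 < lastCoord n x := hx
  refine (lintegral_enorm_sub_le volume (isOpen_upperHalf n) (convex_upperHalf n) hu hB
    (fun z hz => hm.trans_le (hlow z hz)) hx hR).trans ?_
  rw [← lintegral_mul_const _ (by fun_prop), ← lintegral_const_mul _ (by fun_prop)]
  refine setLIntegral_mono' measurableSet_Ioo fun t ht => ?_
  rw [← mul_assoc (ENNReal.ofReal (t ^ _))]
  gcongr
  refine lintegral_enorm_fderiv_segment_le hp u x hB hm ht.1 (fun z hz => ?_) fun z hz => ?_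
  · rw [lastCoord_add_smul_sub]
    nlinarith [mul_nonneg ht.1.le (sub_nonneg.2 (hlow z hz)),
      mul_nonneg (sub_nonneg.2 ht.2.le) hx0.le]
  · rw [lastCoord_add_smul_sub]
    nlinarith [mul_nonneg ht.1.le (sub_nonneg.2 (hup z hz)),
      mul_nonneg (sub_nonneg.2 ht.2.le) (sub_nonneg.2 hxm)]

theorem lintegral_Ioo_rpow_lt_top {r : ℝ} (hr : -1 < r) :
    ∫⁻ t in Ioo (0 : ℝ) 1, ENNReal.ofReal (t ^ r) < ⊤ :=
  ((intervalIntegral.integrableOn_Ioo_rpow_iff zero_lt_one).2 hr).lintegral_lt_top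

theorem abs_sub_mul_measureReal_ball_le {n : ℕ} (hn : 1 ≤ n) {p γ : ℝ} (hp : 1 < p)
    (hs : -1 < -((n + max γ 0) / p))
    {u : EuclideanSpace ℝ (Fin n) → ℝ} (hu : ContDiffOn ℝ 1 u (upperHalf n))
    (hE : energy n γ p u < ⊤) {x y : EuclideanSpace ℝ (Fin n)} (hx : x ∈ upperHalf n)
    (hy : y ∈ upperHalf n) (hxy : x ≠ y) :
    ∃ c : EuclideanSpace ℝ (Fin n),
      |u x - u y| * volume.real (Metric.ball c ‖x - y‖) ≤
        2 * (4 * ‖x - y‖ *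
          ((∫⁻ t in Ioo (0 : ℝ) 1, ENNReal.ofReal (t ^ (-((n + max γ 0) / p)))).toReal *
            ((4 ^ |γ| * max (max (lastCoord n x) (lastCoord n y)) ‖x - y‖ ^ (-γ) *
                (energy n γ p u).toReal) ^ (1 / p) *
              volume.real (Metric.ball c ‖x - y‖) ^ (1 - 1 / p)))) := by
  have hp0 : 0 < p := by linarith
  have hp1 : 0 ≤ 1 - 1 / p := by
    rw [sub_nonneg, div_le_one hp0]; exact hp.le
  set d := ‖x - y‖ with hd
  set m := max (max (lastCoord n x) (lastCoord n y)) d with hmdef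
  have hd0 : 0 < d := norm_pos_iff.2 (sub_ne_zero.2 hxy)
  have hx0 : 0 < lastCoord n x := hx
  have hy0 : 0 < lastCoord n y := hy
  have hxm : lastCoord n x ≤ m := (le_max_left _ _).trans (le_max_left _ _)
  have hym : lastCoord n y ≤ m := (le_max_right _ _).trans (le_max_left _ _)
  have hdm : d ≤ m := le_max_right _ _
  have hm0 : 0 < m := hd0.trans_le hdm
  have hmx : m ≤ lastCoord n x + d := by
    have := neg_le_of_abs_le (abs_lastCoord_sub_le x y)
    refine max_le (max_le ?_ ?_) ?_ <;> linarith
  set e : EuclideanSpace ℝ (Fin n) :=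
    EuclideanSpace.single ⟨n - 1, Nat.sub_lt hn one_pos⟩ 1 with he
  have hen : ‖e‖ = 1 := by simp [he]
  set c := x + (2 * d) • e with hc
  have hcn : lastCoord n c = lastCoord n x + 2 * d := by
    simp [lastCoord_eq hn, hc, he]
  have hcx : ‖c - x‖ = 2 * d := by
    rw [hc, add_sub_cancel_left, norm_smul, hen, mul_one, norm_of_nonneg (by positivity)]
  refine ⟨c, ?_⟩
  set B := Metric.ball c d with hBdef
  have hB : MeasurableSet B := measurableSet_ball
  have hzc : ∀ z ∈ B, ‖z - c‖ < d := fun z hz => mem_ball_iff_norm.1 hz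
  have hzx : ∀ z ∈ B, ‖z - x‖ ≤ 4 * d := fun z hz => by
    have := norm_sub_le_norm_sub_add_norm_sub z c x
    linarith [hzc z hz]
  have hzy : ∀ z ∈ B, ‖z - y‖ ≤ 4 * d := fun z hz => by
    have h1 := norm_sub_le_norm_sub_add_norm_sub z c y
    have h2 := norm_sub_le_norm_sub_add_norm_sub c x y
    linarith [hzc z hz]
  have hlow : ∀ z ∈ B, m ≤ lastCoord n z := fun z hz => by
    have := neg_le_of_abs_le (abs_lastCoord_sub_le z c)
    linarith [hzc z hz]
  have hup : ∀ z ∈ B, lastCoord n z ≤ 4 * m := fun z hz => by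
    have := le_of_abs_le (abs_lastCoord_sub_le z c)
    linarith [hzc z hz]
  have hBs : B ⊆ upperHalf n := fun z hz => hm0.trans_le (hlow z hz)
  have h1 := lintegral_enorm_sub_ball_le (γ := γ) hp hu hx hB hm0 hzx (by linarith) hlow hup
  have h2 := lintegral_enorm_sub_ball_le (γ := γ) hp hu hy hB hm0 hzy (by linarith) hlow hup
  set M := ENNReal.ofReal (4 * d) *
    ((∫⁻ t in Ioo (0 : ℝ) 1, ENNReal.ofReal (t ^ (-((n + max γ 0) / p)))) *
      ((ENNReal.ofReal (4 ^ |γ| * m ^ (-γ)) * energy n γ p u) ^ (1 / p) *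
        volume B ^ (1 - 1 / p))) with hM
  have hsum : ‖u x - u y‖ₑ * volume B ≤ 2 * M := by
    calc ‖u x - u y‖ₑ * volume B = ∫⁻ _ in B, ‖u x - u y‖ₑ := by simp
      _ ≤ ∫⁻ z in B, (‖u z - u x‖ₑ + ‖u z - u y‖ₑ) := by
          refine lintegral_mono fun z => ?_
          rw [← edist_eq_enorm_sub, ← edist_eq_enorm_sub, ← edist_eq_enorm_sub]
          exact edist_triangle_left _ _ _
      _ = (∫⁻ z in B, ‖u z - u x‖ₑ) + ∫⁻ z in B, ‖u z - u y‖ₑ :=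
          lintegral_add_left' (((hu.continuousOn.mono hBs).aemeasurable hB).sub_const _).enorm _
      _ ≤ 2 * M := by rw [two_mul]; exact add_le_add h1 h2
  have hM_top : M ≠ ⊤ := by
    refine ENNReal.mul_ne_top ENNReal.ofReal_ne_top
      (ENNReal.mul_ne_top (lintegral_Ioo_rpow_lt_top hs).ne (ENNReal.mul_ne_top ?_ ?_))
    · exact ENNReal.rpow_ne_top_of_nonneg (by positivity)
        (ENNReal.mul_ne_top ENNReal.ofReal_ne_top hE.ne)
    · exact ENNReal.rpow_ne_top_of_nonneg hp1 measure_ball_lt_top.ne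
  have hreal := ENNReal.toReal_mono (ENNReal.mul_ne_top ENNReal.ofNat_ne_top hM_top) hsum
  simpa only [hM, measureReal_def, ENNReal.toReal_mul, ← ENNReal.toReal_rpow, toReal_enorm,
    Real.norm_eq_abs,
    ENNReal.toReal_ofNat, ENNReal.toReal_ofReal (show 0 ≤ 4 * d by positivity),
    ENNReal.toReal_ofReal (show 0 ≤ 4 ^ |γ| * m ^ (-γ) by positivity)] using hreal

/-- Weighted Morrey–Sobolev inequality on the half-space, case `γ < p - n`. -/
theorem weighted_morrey_sobolev_lt (n : ℕ) (hn : 1 ≤ n) (p γ : ℝ)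
    (hnp : (n : ℝ) < p) (hγ : γ < p - n) :
    ∃ C : ℝ, 0 < C ∧
      ∀ u : EuclideanSpace ℝ (Fin n) → ℝ,
        ContDiffOn ℝ 1 u (upperHalf n) →
        energy n γ p u < ⊤ →
        ∀ x ∈ upperHalf n, ∀ y ∈ upperHalf n,
          |u x - u y| ≤
            C * (‖x - y‖ ^ (1 - (n : ℝ) / p) /
                max (max (lastCoord n x) (lastCoord n y)) ‖x - y‖ ^ (γ / p)) *
              (energy n γ p u).toReal ^ (1 / p) := by
  have hn1 : (1 : ℝ) ≤ n := by exact_mod_cast hn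
  have hp : 1 < p := by linarith
  have hp0 : 0 < p := by linarith
  have hs : -1 < -((n + max γ 0) / p) := by
    rw [neg_lt_neg_iff, div_lt_one hp0]
    rcases max_cases γ 0 with h | h <;> linarith
  set s := (∫⁻ t in Ioo (0 : ℝ) 1, ENNReal.ofReal (t ^ (-((n + max γ 0) / p)))).toReal with hsdef
  have hs0 : 0 ≤ s := ENNReal.toReal_nonneg
  set ω := volume.real (Metric.ball (0 : EuclideanSpace ℝ (Fin n)) 1) with hω
  have hω0 : 0 < ω := ENNReal.toReal_pos (Metric.measure_ball_pos _ _ one_pos).ne'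
    measure_ball_lt_top.ne
  refine ⟨8 * s * (4 ^ |γ|) ^ (1 / p) * ω ^ (-(1 / p)) + 1, by positivity,
    fun u hu hE x hx y hy => ?_⟩
  have hx0 : 0 < lastCoord n x := hx
  set d := ‖x - y‖ with hd
  set m := max (max (lastCoord n x) (lastCoord n y)) d with hmdef
  have hm0 : 0 < m := hx0.trans_le ((le_max_left _ _).trans (le_max_left _ _))
  rcases eq_or_ne x y with hxy | hxy
  · rw [hxy, sub_self, abs_zero]
    positivity
  have hd0 : 0 < d := norm_pos_iff.2 (sub_ne_zero.2 hxy)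
  obtain ⟨c, h⟩ := abs_sub_mul_measureReal_ball_le hn hp hs hu hE hx hy hxy
  rw [← hd, ← hmdef, ← hsdef] at h
  set ε := (energy n γ p u).toReal
  have hε : 0 ≤ ε := ENNReal.toReal_nonneg
  have hV : volume.real (Metric.ball c d) = d ^ (n : ℝ) * ω := by
    rw [measureReal_def, Measure.addHaar_ball_of_pos volume c hd0, finrank_euclideanSpace_fin,
      ENNReal.toReal_mul, ENNReal.toReal_ofReal (by positivity), rpow_natCast]
    rfl
  set V := volume.real (Metric.ball c d)
  have hV0 : 0 < V := by rw [hV]; positivity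
  have hVpow : V ^ (1 - 1 / p) = d ^ (-((n : ℝ) / p)) * ω ^ (-(1 / p)) * V := by
    rw [sub_eq_neg_add, rpow_add hV0, rpow_one, hV, mul_rpow (by positivity) hω0.le,
      ← rpow_mul hd0.le]
    ring_nf
  have hkey : |u x - u y| ≤
      (8 * s * (4 ^ |γ|) ^ (1 / p) * ω ^ (-(1 / p))) * (d ^ (1 - (n : ℝ) / p) / m ^ (γ / p)) *
        ε ^ (1 / p) := by
    refine le_of_mul_le_mul_right (h.trans_eq ?_) hV0
    rw [hVpow, mul_rpow (by positivity) hε, mul_rpow (by positivity) (by positivity),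
      ← rpow_mul hm0.le, sub_eq_add_neg 1 ((n : ℝ) / p), rpow_add hd0, rpow_one,
      div_eq_mul_inv (_ * _), ← rpow_neg hm0.le, show -γ * (1 / p) = -(γ / p) by ring]
    ring
  refine hkey.trans ?_
  gcongr
  linarith
end
end

section
/- Let γ ∈ ℝ and 1 < p < +∞. There exists a constant C > 0 such that: if ω : (0,+∞) × (0,+∞) → [0, +∞) is continuous and satisfies, for every smooth compactly supported function u ∈ C_c^∞((0,+∞)) and for all x, y ∈ (0,+∞), the estimate |u(x) − u(y)| ≤ ω(x, y) · ( ∫₀^∞ |u′(z)|^p z^γ dz )^{1/p}, then for all x, y ∈ (0,+∞): if γ > p − 1, then ω(x, y) ≥ C · |x − y|^{1−1/p} · min(x,y)^{1−(1+γ)/p} / max(x,y)^{1−1/p}; if γ = p − 1, then ω(x, y) ≥ C · |ln(x/y)|^{1−1/p}; and if γ < p − 1, then ω(x, y) ≥ C · |x − y|^{1−1/p} / max(x,y)^{γ/p}. -/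
open MeasureTheory Real Set
open scoped ENNReal

noncomputable section

/-- The one-dimensional weighted energy `∫₀^∞ |u'(z)|^p z^γ dz`, as a value in `[0, +∞]`. -/
def energy1 (γ p : ℝ) (u : ℝ → ℝ) : ℝ≥0∞ :=
  ∫⁻ z in Set.Ioi (0 : ℝ), ENNReal.ofReal (|deriv u z| ^ p * z ^ γ)

/-- A fixed smooth bump on the line, equal to `1` at the origin and supported in `[-1, 1]`. -/
def unitBump : ContDiffBump (0 : ℝ) := ⟨1 / 2, 1, by norm_num, by norm_num⟩

lemma unitBump_zero : unitBump 0 = 1 :=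
  unitBump.one_of_mem_closedBall (Metric.mem_closedBall_self unitBump.rIn_pos.le)

lemma unitBump_eq_zero {s : ℝ} (hs : 1 ≤ |s|) : unitBump s = 0 :=
  unitBump.zero_of_le_dist (by simpa [unitBump, Real.dist_eq] using hs)

lemma exists_abs_deriv_unitBump_le : ∃ M : ℝ, 0 < M ∧ ∀ s, |deriv unitBump s| ≤ M := by
  have hc : Continuous (deriv unitBump) :=
    (unitBump.contDiff (n := 1)).continuous_deriv le_rfl
  obtain ⟨M, hM⟩ := hc.bounded_above_of_compact_support unitBump.hasCompactSupport.deriv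
  exact ⟨max M 1, by positivity, fun s => (hM s).trans (le_max_left _ _)⟩

/-- The bump in the variable `log z`, centred at `log a` and of half-width `L`. -/
def logBump (a L z : ℝ) : ℝ :=
  if 0 < z then unitBump ((log z - log a) / L) else 0

lemma logBump_of_pos {a L z : ℝ} (hz : 0 < z) :
    logBump a L z = unitBump ((log z - log a) / L) := if_pos hz

lemma logBump_self {a L : ℝ} (ha : 0 < a) : logBump a L a = 1 := by
  simp [logBump_of_pos ha, unitBump_zero]

lemma logBump_eq_zero {a L z : ℝ} (hL : 0 < L) (h : L ≤ |log z - log a|) :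
    logBump a L z = 0 := by
  unfold logBump
  split_ifs
  · exact unitBump_eq_zero (by rwa [abs_div, abs_of_pos hL, one_le_div hL])
  · rfl

lemma logBump_eq_zero_of_notMem {a L z : ℝ} (ha : 0 < a) (hL : 0 < L)
    (h : z ∉ Icc (a * exp (-L)) (a * exp L)) : logBump a L z = 0 := by
  rcases le_or_gt z 0 with hz | hz
  · exact if_neg hz.not_gt
  apply logBump_eq_zero hL
  by_contra! hlt
  rw [abs_lt] at hlt
  refine h ⟨?_, ?_⟩
  · rw [← log_le_log_iff (by positivity) hz, log_mul ha.ne' (exp_ne_zero _), log_exp]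
    linarith
  · rw [← log_le_log_iff hz (by positivity), log_mul ha.ne' (exp_ne_zero _), log_exp]
    linarith

lemma tsupport_logBump_subset {a L : ℝ} (ha : 0 < a) (hL : 0 < L) :
    tsupport (logBump a L) ⊆ Icc (a * exp (-L)) (a * exp L) := by
  refine closure_minimal (fun z hz => ?_) isClosed_Icc
  by_contra h
  exact hz (logBump_eq_zero_of_notMem ha hL h)

lemma hasCompactSupport_logBump {a L : ℝ} (ha : 0 < a) (hL : 0 < L) :
    HasCompactSupport (logBump a L) :=
  isCompact_Icc.of_isClosed_subset (isClosed_tsupport _) (tsupport_logBump_subset ha hL)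

lemma tsupport_logBump_subset_Ioi {a L : ℝ} (ha : 0 < a) (hL : 0 < L) :
    tsupport (logBump a L) ⊆ Ioi 0 := fun _ hz =>
  lt_of_lt_of_le (by positivity) (tsupport_logBump_subset ha hL hz).1

lemma logBump_eventuallyEq {a L z : ℝ} (hz : 0 < z) :
    logBump a L =ᶠ[nhds z] fun z => unitBump ((log z - log a) / L) := by
  filter_upwards [lt_mem_nhds hz] with w hw using logBump_of_pos hw

lemma contDiff_logBump {a L : ℝ} (ha : 0 < a) (hL : 0 < L) :
    ContDiff ℝ (⊤ : ℕ∞) (logBump a L) := by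
  rw [contDiff_iff_contDiffAt]
  intro z
  rcases le_or_gt z 0 with hz | hz
  · have hz' : z ∉ tsupport (logBump a L) := fun h =>
      hz.not_gt (tsupport_logBump_subset_Ioi ha hL h)
    exact contDiffAt_const.congr_of_eventuallyEq (notMem_tsupport_iff_eventuallyEq.1 hz')
  · refine ContDiffAt.congr_of_eventuallyEq ?_ (logBump_eventuallyEq hz)
    exact unitBump.contDiff.contDiffAt.comp z
      (((contDiffAt_log.2 hz.ne').sub contDiffAt_const).div_const L)

lemma abs_deriv_logBump_le {a L z M : ℝ} (hL : 0 < L) (hz : 0 < z)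
    (hM : ∀ s, |deriv unitBump s| ≤ M) : |deriv (logBump a L) z| ≤ M * L⁻¹ * z⁻¹ := by
  have hin : HasDerivAt (fun z => (log z - log a) / L) (z⁻¹ / L) z :=
    ((hasDerivAt_log hz.ne').sub_const _).div_const L
  have hout : HasDerivAt unitBump (deriv unitBump ((log z - log a) / L))
      ((log z - log a) / L) :=
    ((unitBump.contDiff (n := 1)).differentiable one_ne_zero _).hasDerivAt
  have hder : HasDerivAt (fun z => unitBump ((log z - log a) / L))
      (deriv unitBump ((log z - log a) / L) * (z⁻¹ / L)) z :=
    HasDerivAt.comp (h₂ := unitBump) (h := fun z => (log z - log a) / L) z hout hin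
  rw [(logBump_eventuallyEq hz).deriv_eq, hder.deriv, abs_mul,
    abs_of_pos (show 0 < z⁻¹ / L by positivity), mul_assoc]
  gcongr
  · exact (abs_nonneg _).trans (hM 0)
  · exact hM _
  · rw [div_eq_inv_mul]

lemma rpow_le_of_mem_Icc_exp {a L z : ℝ} (q : ℝ) (ha : 0 < a)
    (hz : z ∈ Icc (a * exp (-L)) (a * exp L)) : z ^ q ≤ a ^ q * exp (|q| * L) := by
  have hz0 : 0 < z := lt_of_lt_of_le (by positivity) hz.1
  have h1 : log a - L ≤ log z := by
    simpa [log_mul ha.ne', sub_eq_add_neg] using log_le_log (by positivity) hz.1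
  have h2 : log z ≤ log a + L := by
    simpa [log_mul ha.ne'] using log_le_log hz0 hz.2
  rw [rpow_def_of_pos hz0, rpow_def_of_pos ha, ← exp_add, exp_le_exp]
  have h3 : |log z - log a| ≤ L := abs_le.2 ⟨by linarith, by linarith⟩
  have h4 : (log z - log a) * q ≤ |q| * L := by
    calc (log z - log a) * q ≤ |(log z - log a) * q| := le_abs_self _
      _ = |q| * |log z - log a| := by rw [abs_mul, mul_comm]
      _ ≤ |q| * L := by gcongr
  linarith

lemma lintegral_inv_Icc_exp {a L : ℝ} (ha : 0 < a) (hL : 0 < L) :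
    ∫⁻ z in Icc (a * exp (-L)) (a * exp L), ENNReal.ofReal z⁻¹ = ENNReal.ofReal (2 * L) := by
  have hl : 0 < a * exp (-L) := by positivity
  have hle : a * exp (-L) ≤ a * exp L := by gcongr; linarith
  have hint : IntegrableOn (fun z : ℝ => z⁻¹) (Icc (a * exp (-L)) (a * exp L)) :=
    (continuousOn_inv₀.mono fun z hz => (hl.trans_le hz.1).ne').integrableOn_Icc
  rw [← ofReal_integral_eq_lintegral_ofReal hint]
  · rw [integral_Icc_eq_integral_Ioc, ← intervalIntegral.integral_of_le hle,
      integral_inv_of_pos hl (by positivity), mul_div_mul_left _ _ ha.ne', ← exp_sub, log_exp]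
    ring_nf
  · filter_upwards [ae_restrict_mem measurableSet_Icc] with z hz
    exact inv_nonneg.2 (hl.trans_le hz.1).le

lemma energy1_logBump_le {γ p a L M : ℝ} (hp : 1 < p) (ha : 0 < a) (hL : 0 < L) (hM0 : 0 < M)
    (hM : ∀ s, |deriv unitBump s| ≤ M) :
    energy1 γ p (logBump a L) ≤ ENNReal.ofReal
      ((M * L⁻¹) ^ p * (a ^ (γ + 1 - p) * exp (|γ + 1 - p| * L)) * (2 * L)) := by
  set A : ℝ := (M * L⁻¹) ^ p * (a ^ (γ + 1 - p) * exp (|γ + 1 - p| * L)) with hA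
  set I := Icc (a * exp (-L)) (a * exp L) with hI
  have hA0 : 0 ≤ A := by positivity
  have hpt : ∀ z ∈ Ioi (0 : ℝ), ENNReal.ofReal (|deriv (logBump a L) z| ^ p * z ^ γ) ≤
      I.indicator (fun z => ENNReal.ofReal A * ENNReal.ofReal z⁻¹) z := by
    intro z (hz : 0 < z)
    by_cases hzI : z ∈ I
    · rw [indicator_of_mem hzI, ← ENNReal.ofReal_mul hA0]
      apply ENNReal.ofReal_le_ofReal
      calc |deriv (logBump a L) z| ^ p * z ^ γ ≤ (M * L⁻¹ * z⁻¹) ^ p * z ^ γ := by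
            gcongr
            exact abs_deriv_logBump_le hL hz hM
        _ = (M * L⁻¹) ^ p * z ^ (γ + 1 - p) * z⁻¹ := by
            rw [mul_rpow (by positivity) (by positivity), inv_rpow hz.le, rpow_sub hz,
              rpow_add hz, rpow_one]
            field_simp
        _ ≤ A * z⁻¹ := by
            rw [hA]
            gcongr
            exact rpow_le_of_mem_Icc_exp _ ha hzI
    · have h0 : deriv (logBump a L) z = 0 := by
        by_contra h
        exact hzI (tsupport_logBump_subset ha hL (support_deriv_subset h))
      simp [h0, zero_rpow (by linarith : p ≠ 0)]
  calc energy1 γ p (logBump a L)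
      ≤ ∫⁻ z in Ioi (0 : ℝ), I.indicator (fun z => ENNReal.ofReal A * ENNReal.ofReal z⁻¹) z :=
        setLIntegral_mono' measurableSet_Ioi hpt
    _ ≤ ∫⁻ z, I.indicator (fun z => ENNReal.ofReal A * ENNReal.ofReal z⁻¹) z :=
        setLIntegral_le_lintegral _ _
    _ = ENNReal.ofReal (A * (2 * L)) := by
        rw [lintegral_indicator measurableSet_Icc, lintegral_const_mul _ (by fun_prop),
          lintegral_inv_Icc_exp ha hL, ENNReal.ofReal_mul hA0]

/-- Any number `w` controlling the oscillation of test functions between `a` and a point at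
logarithmic distance at least `L` is bounded below by testing with a bump around `a`. -/
lemma exists_le_of_oscillation_bound (γ p : ℝ) (hp : 1 < p) :
    ∃ C : ℝ, 0 < C ∧ ∀ a b L w : ℝ, 0 < a → 0 < L → L ≤ |log b - log a| →
      |γ + 1 - p| * L ≤ |γ + 1 - p| → 0 ≤ w →
      (∀ u : ℝ → ℝ, ContDiff ℝ (⊤ : ℕ∞) u → HasCompactSupport u → tsupport u ⊆ Ioi 0 →
        |u a - u b| ≤ w * (energy1 γ p u).toReal ^ (1 / p)) →
      C * (L ^ (1 - 1 / p) * a ^ (1 - (1 + γ) / p)) ≤ w := by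
  obtain ⟨M, hM0, hM⟩ := exists_abs_deriv_unitBump_le
  have hp0 : 0 < p := by linarith
  set K : ℝ := M ^ p * exp |γ + 1 - p| * 2 with hK
  have hK0 : 0 < K := by positivity
  refine ⟨K ^ (-(1 / p)), by positivity, fun a b L w ha hL hLb hLq hw h => ?_⟩
  have h1 := h _ (contDiff_logBump ha hL) (hasCompactSupport_logBump ha hL)
    (tsupport_logBump_subset_Ioi ha hL)
  rw [logBump_self ha, logBump_eq_zero hL hLb, sub_zero, abs_one] at h1
  have hE : (energy1 γ p (logBump a L)).toReal ≤ K * (L ^ (1 - p) * a ^ (γ + 1 - p)) := by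
    refine (ENNReal.toReal_le_of_le_ofReal (by positivity)
      (energy1_logBump_le hp ha hL hM0 hM)).trans ?_
    calc _ ≤ (M * L⁻¹) ^ p * (a ^ (γ + 1 - p) * exp |γ + 1 - p|) * (2 * L) := by gcongr
      _ = K * (L ^ (1 - p) * a ^ (γ + 1 - p)) := by
        rw [mul_rpow hM0.le (by positivity), inv_rpow hL.le, rpow_sub hL, rpow_one, hK]
        field_simp
  have h2 : 1 ≤ w * (K * (L ^ (1 - p) * a ^ (γ + 1 - p))) ^ (1 / p) :=
    h1.trans (by gcongr)
  calc K ^ (-(1 / p)) * (L ^ (1 - 1 / p) * a ^ (1 - (1 + γ) / p))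
      = ((K * (L ^ (1 - p) * a ^ (γ + 1 - p))) ^ (1 / p))⁻¹ := by
        rw [mul_rpow hK0.le (by positivity),
          mul_rpow (rpow_nonneg hL.le _) (rpow_nonneg ha.le _),
          ← rpow_mul hL.le, ← rpow_mul ha.le, mul_inv, mul_inv, ← rpow_neg hK0.le,
          ← rpow_neg hL.le, ← rpow_neg ha.le]
        congr 3 <;> field_simp <;> ring
    _ ≤ w := by
        rw [inv_le_iff_one_le_mul₀ (by positivity)]
        exact h2

lemma exists_le_of_oscillation_bound_of_lt (γ p : ℝ) (hp : 1 < p) :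
    ∃ C : ℝ, 0 < C ∧ ∀ s t w : ℝ, 0 < s → s < t → 0 ≤ w →
      (∀ u : ℝ → ℝ, ContDiff ℝ (⊤ : ℕ∞) u → HasCompactSupport u → tsupport u ⊆ Ioi 0 →
        |u s - u t| ≤ w * (energy1 γ p u).toReal ^ (1 / p)) →
      C * ((t - s) ^ (1 - 1 / p) * s ^ (1 - (1 + γ) / p) / t ^ (1 - 1 / p)) ≤ w ∧
      (γ = p - 1 → C * |log (s / t)| ^ (1 - 1 / p) ≤ w) ∧
      C * ((t - s) ^ (1 - 1 / p) / t ^ (γ / p)) ≤ w := by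
  obtain ⟨C, hC, H⟩ := exists_le_of_oscillation_bound γ p hp
  refine ⟨C, hC, fun s t w hs hst hw h => ?_⟩
  have ht : 0 < t := hs.trans hst
  have hp0 : 0 < p := by linarith
  have hlog : log s < log t := log_lt_log hs hst
  have hL : 0 < (t - s) / t := div_pos (sub_pos.2 hst) ht
  have hL1 : (t - s) / t ≤ 1 := (div_le_one ht).2 (by linarith)
  have hLlog : (t - s) / t ≤ |log t - log s| := by
    rw [abs_of_pos (sub_pos.2 hlog), ← log_div ht.ne' hs.ne']
    have := one_sub_inv_le_log_of_pos (div_pos ht hs)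
    rwa [inv_div, one_sub_div ht.ne'] at this
  have hLq : |γ + 1 - p| * ((t - s) / t) ≤ |γ + 1 - p| :=
    mul_le_of_le_one_right (abs_nonneg _) hL1
  refine ⟨?_, fun hγ => ?_, ?_⟩
  · have := H s t _ w hs hL hLlog hLq hw h
    rw [div_rpow (by linarith) ht.le] at this
    convert this using 2
    ring
  · have hq : γ + 1 - p = 0 := by linarith
    have := H s t |log (s / t)| w hs (abs_pos.2 ?_) ?_ (by simp [hq]) hw h
    · rwa [show 1 - (1 + γ) / p = 0 by rw [hγ]; field_simp; ring, rpow_zero, mul_one] at this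
    · rw [log_div hs.ne' ht.ne']
      linarith
    · rw [log_div hs.ne' ht.ne', abs_sub_comm]
  · have := H t s _ w ht hL (by rwa [abs_sub_comm]) hLq hw
      fun u h1 h2 h3 => by rw [abs_sub_comm]; exact h u h1 h2 h3
    rw [div_rpow (by linarith) ht.le] at this
    convert this using 2
    rw [show 1 - (1 + γ) / p = (1 - 1 / p) - γ / p by ring, rpow_sub ht (1 - 1 / p)]
    have : t ^ (1 - 1 / p) ≠ 0 := (rpow_pos_of_pos ht _).ne'
    generalize t ^ (1 - 1 / p) = r at this ⊢
    field_simp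

/-- Optimality of the one-dimensional weighted Morrey–Sobolev inequality for compactly
supported functions. -/
theorem weighted_morrey_sobolev_optimal_compact_one_dim (γ p : ℝ) (hp : 1 < p) :
    ∃ C : ℝ, 0 < C ∧
      ∀ ω : ℝ → ℝ → ℝ,
        ContinuousOn (fun q : ℝ × ℝ => ω q.1 q.2) (Set.Ioi 0 ×ˢ Set.Ioi 0) →
        (∀ x ∈ Set.Ioi (0 : ℝ), ∀ y ∈ Set.Ioi (0 : ℝ), 0 ≤ ω x y) →
        (∀ u : ℝ → ℝ, ContDiff ℝ (⊤ : ℕ∞) u → HasCompactSupport u → tsupport u ⊆ Set.Ioi 0 →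
          ∀ x ∈ Set.Ioi (0 : ℝ), ∀ y ∈ Set.Ioi (0 : ℝ),
            |u x - u y| ≤ ω x y * (energy1 γ p u).toReal ^ (1 / p)) →
        ∀ x ∈ Set.Ioi (0 : ℝ), ∀ y ∈ Set.Ioi (0 : ℝ),
          (p - 1 < γ →
            C * (|x - y| ^ (1 - 1 / p) * min x y ^ (1 - (1 + γ) / p) /
              max x y ^ (1 - 1 / p)) ≤ ω x y) ∧
          (γ = p - 1 →
            C * |Real.log (x / y)| ^ (1 - 1 / p) ≤ ω x y) ∧
          (γ < p - 1 →
            C * (|x - y| ^ (1 - 1 / p) / max x y ^ (γ / p)) ≤ ω x y) := by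
  obtain ⟨C, hC, H⟩ := exists_le_of_oscillation_bound_of_lt γ p hp
  have he : 1 - 1 / p ≠ 0 := by
    have := (div_lt_one (by linarith : 0 < p)).2 hp
    linarith
  refine ⟨C, hC, fun ω _ hω h x hx y hy => ?_⟩
  have hw := hω x hx y hy
  rcases lt_trichotomy x y with hxy | rfl | hxy
  · obtain ⟨h1, h2, h3⟩ := H x y _ hx hxy hw fun u hu hc hs => h u hu hc hs x hx y hy
    rw [min_eq_left hxy.le, max_eq_right hxy.le, abs_sub_comm, abs_of_pos (sub_pos.2 hxy)]
    exact ⟨fun _ => h1, h2, fun _ => h3⟩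
  · have hx0 : x ≠ 0 := (mem_Ioi.1 hx).ne'
    simp only [sub_self, abs_zero, div_self hx0, log_one, zero_rpow he, zero_mul, zero_div,
      mul_zero]
    exact ⟨fun _ => hw, fun _ => hw, fun _ => hw⟩
  · obtain ⟨h1, h2, h3⟩ := H y x _ hy hxy hw fun u hu hc hs => by
      rw [abs_sub_comm]; exact h u hu hc hs x hx y hy
    rw [min_eq_right hxy.le, max_eq_left hxy.le, abs_of_pos (sub_pos.2 hxy)]
    rw [← inv_div, log_inv, abs_neg] at h2
    exact ⟨fun _ => h1, h2, fun _ => h3⟩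
end
end
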